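/- Let q = 1 and suppose E[G²] < ∞. If 0 < δ < M_1(ε), then the limit lim_{σ_w → 0} AMSE(σ_w) exists and is strictly positive. -/

import Mathlib

open MeasureTheory ProbabilityTheory Real Filter Set

noncomputable section

/-- The standard Gaussian measure on `ℝ`. -/
def stdGaussian : Measure ℝ := gaussianReal 0 1

/-- Soft thresholding, i.e. `η₁(u;χ) = sign(u)·max(|u|−χ,0)`. -/
def soft (u χ : ℝ) : ℝ := Real.sign u * max (|u| - χ) 0

/-- `M₁(ε) = inf_{χ ≥ 0} [(1−ε)·E[η₁(Z;χ)²] + ε(1+χ²)]`, `Z ~ N(0,1)`. -/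
def M1 (ε : ℝ) : ℝ :=
  ⨅ χ : NNReal, ((1 - ε) * ∫ z, (soft z (χ:ℝ))^2 ∂stdGaussian + ε * (1 + (χ:ℝ)^2))

/-- The law of `B`: the mixture `(1−ε)δ₀ + ε·g`. -/
def mix (ε : ℝ) (g : Measure ℝ) : Measure ℝ :=
  ENNReal.ofReal (1 - ε) • Measure.dirac (0:ℝ) + ENNReal.ofReal ε • g

/-- `min_{χ ≥ 0} E[(η(B+σZ;χ) − B)²]` where `B ~ μB`, `Z ~ N(0,1)` independent. -/
def riskMin (η : ℝ → ℝ → ℝ) (μB : Measure ℝ) (σ : ℝ) : ℝ :=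
  ⨅ χ : NNReal, ∫ b, (∫ z, (η (b + σ * z) (χ:ℝ) - b)^2 ∂stdGaussian) ∂μB

theorem soft_eq_sub_clamp {χ : ℝ} (hχ : 0 ≤ χ) (u : ℝ) :
    soft u χ = u - max (-χ) (min u χ) := by
  unfold soft
  rcases lt_trichotomy u 0 with h | h | h
  · rw [Real.sign_of_neg h, abs_of_neg h, min_eq_left (h.le.trans hχ)]
    rcases le_total u (-χ) with h' | h'
    · rw [max_eq_left h', max_eq_left (by linarith)]; ring
    · rw [max_eq_right h', max_eq_right (by linarith)]; ring
  · subst h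
    simp [hχ]
  · rw [Real.sign_of_pos h, abs_of_pos h]
    rcases le_total u χ with h' | h'
    · rw [min_eq_left h', max_eq_right (by linarith : u - χ ≤ 0), max_eq_right (by linarith)]; ring
    · rw [min_eq_right h', max_eq_left (by linarith : 0 ≤ u - χ), max_eq_right (by linarith)]; ring

theorem soft_add_sub {χ : ℝ} (hχ : 0 ≤ χ) (b z : ℝ) :
    soft (b + z) χ - b = -max (-χ - z) (min b (χ - z)) := by
  have h1 : min (b + z) χ = min b (χ - z) + z := by rw [min_add]; ring_nf
  have h2 : max (-χ) (min b (χ - z) + z) = max (-χ - z) (min b (χ - z)) + z := by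
    rw [max_add]; ring_nf
  rw [soft_eq_sub_clamp hχ, h1, h2]
  ring

theorem soft_scale {σ χ : ℝ} (hσ : 0 < σ) (hχ : 0 ≤ χ) (b z : ℝ) :
    soft (b + σ * z) χ - b = σ * (soft (b / σ + z) (χ / σ) - b / σ) := by
  rw [soft_add_sub hχ, soft_add_sub (div_nonneg hχ hσ.le), mul_neg, mul_max_of_nonneg _ _ hσ.le,
    mul_min_of_nonneg _ _ hσ.le]
  congr 3 <;> field_simp

/-- Squared clamping of a point to an interval grows as the point moves away from `0`. -/
theorem sq_clamp_le {l u a b : ℝ} (h : (0 ≤ a ∧ a ≤ b) ∨ (b ≤ a ∧ a ≤ 0)) :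
    (max l (min a u)) ^ 2 ≤ (max l (min b u)) ^ 2 := by
  rcases h with ⟨h0, hab⟩ | ⟨hab, h0⟩
  · rcases le_total 0 u with hu | hu
    · exact pow_le_pow_left₀ (le_max_of_le_right (le_min h0 hu)) (by gcongr) 2
    · rw [min_eq_right (hu.trans h0), min_eq_right (hu.trans (h0.trans hab))]
  · rcases le_total l 0 with hl | hl
    · have hx : max l (min a u) ≤ 0 := max_le hl ((min_le_left _ _).trans h0)
      have hyx : max l (min b u) ≤ max l (min a u) := by gcongr
      nlinarith
    · rw [max_eq_left ((min_le_left a u).trans (h0.trans hl)),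
        max_eq_left ((min_le_left b u).trans ((hab.trans h0).trans hl))]

/-- The risk of soft thresholding at level `χ` for the mean `b` in unit Gaussian noise. -/
def softRisk (b χ : ℝ) : ℝ := ∫ z, (soft (b + z) χ - b) ^ 2 ∂stdGaussian

instance isProbabilityMeasure_stdGaussian : IsProbabilityMeasure stdGaussian := by
  unfold _root_.stdGaussian; infer_instance

theorem memLp_id_stdGaussian : MemLp id 2 stdGaussian :=
  memLp_id_gaussianReal' 2 (by simp)

theorem integrable_sq_stdGaussian : Integrable (fun z : ℝ => z ^ 2) stdGaussian :=
  memLp_id_stdGaussian.integrable_sq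

theorem integral_sq_stdGaussian : ∫ z, z ^ 2 ∂stdGaussian = 1 := by
  have h := variance_eq_sub memLp_id_stdGaussian
  have h1 : Var[id; stdGaussian] = 1 := by simp [_root_.stdGaussian]
  have h2 : ∫ z, id z ∂stdGaussian = 0 := integral_id_gaussianReal
  rw [h1, h2] at h
  simpa using h.symm

theorem integrable_sub_sq_stdGaussian (t : ℝ) :
    Integrable (fun z : ℝ => (z - t) ^ 2) stdGaussian :=
  (memLp_id_stdGaussian.sub (memLp_const t)).integrable_sq

theorem integral_sub_sq_stdGaussian (t : ℝ) : ∫ z, (z - t) ^ 2 ∂stdGaussian = 1 + t ^ 2 := by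
  have hid : Integrable (fun z : ℝ => z) stdGaussian := memLp_id_stdGaussian.integrable (by norm_num)
  have h2 : ∫ z, z ∂stdGaussian = 0 := integral_id_gaussianReal
  have h : (fun z : ℝ => (z - t) ^ 2) = fun z => z ^ 2 - 2 * t * z + t ^ 2 := by ext; ring
  rw [h, integral_add (f := fun z : ℝ => z ^ 2 - 2 * t * z)
    (integrable_sq_stdGaussian.sub (hid.const_mul _)) (integrable_const _),
    integral_sub integrable_sq_stdGaussian (hid.const_mul _), integral_const_mul, h2,
    integral_sq_stdGaussian]
  simp

theorem continuous_soft_add_sub {χ : ℝ} (hχ : 0 ≤ χ) :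
    Continuous fun p : ℝ × ℝ => (soft (p.1 + p.2) χ - p.1) ^ 2 := by
  simp only [soft_add_sub hχ]
  fun_prop

theorem soft_add_sub_sq_le {χ : ℝ} (hχ : 0 ≤ χ) (b z : ℝ) :
    (soft (b + z) χ - b) ^ 2 ≤ 2 * z ^ 2 + 2 * χ ^ 2 := by
  rw [soft_eq_sub_clamp hχ]
  have h1 : max (-χ) (min (b + z) χ) ≤ χ := max_le (by linarith) (min_le_right _ _)
  have h2 : -χ ≤ max (-χ) (min (b + z) χ) := le_max_left _ _
  generalize max (-χ) (min (b + z) χ) = c at *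
  nlinarith [sq_nonneg (z + c)]

theorem integrable_soft_add_sub_sq {χ : ℝ} (hχ : 0 ≤ χ) (b : ℝ) :
    Integrable (fun z => (soft (b + z) χ - b) ^ 2) stdGaussian := by
  refine ((integrable_sq_stdGaussian.const_mul 2).add (integrable_const (2 * χ ^ 2))).mono'
    ((continuous_soft_add_sub hχ).comp (Continuous.prodMk_right b)).aestronglyMeasurable
    (ae_of_all _ fun z => ?_)
  rw [Real.norm_of_nonneg (sq_nonneg _)]
  exact soft_add_sub_sq_le hχ b z

theorem softRisk_nonneg (b χ : ℝ) : 0 ≤ softRisk b χ := integral_nonneg fun _ => sq_nonneg _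

theorem softRisk_le {χ : ℝ} (hχ : 0 ≤ χ) (b : ℝ) : softRisk b χ ≤ 2 + 2 * χ ^ 2 := by
  refine (integral_mono (integrable_soft_add_sub_sq hχ b)
    ((integrable_sq_stdGaussian.const_mul 2).add (integrable_const (2 * χ ^ 2)))
    (soft_add_sub_sq_le hχ b)).trans ?_
  rw [integral_add' (integrable_sq_stdGaussian.const_mul 2) (integrable_const _),
    integral_const_mul, integral_sq_stdGaussian]
  simp

theorem stronglyMeasurable_softRisk {χ : ℝ} (hχ : 0 ≤ χ) :
    StronglyMeasurable fun b => softRisk b χ :=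
  (continuous_soft_add_sub hχ).stronglyMeasurable.integral_prod_right

theorem integrable_softRisk {χ : ℝ} (hχ : 0 ≤ χ) (μ : Measure ℝ) [IsFiniteMeasure μ] (c : ℝ) :
    Integrable (fun b => softRisk (b / c) χ) μ := by
  refine Integrable.of_bound (C := 2 + 2 * χ ^ 2)
    ((stronglyMeasurable_softRisk hχ).comp_measurable
      (measurable_id.div_const c)).aestronglyMeasurable (ae_of_all _ fun b => ?_)
  rw [Real.norm_of_nonneg (softRisk_nonneg _ _)]
  exact softRisk_le hχ _

/-- The risk of soft thresholding grows as the mean moves away from `0`. -/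
theorem softRisk_mono {χ : ℝ} (hχ : 0 ≤ χ) {a b : ℝ}
    (h : (0 ≤ a ∧ a ≤ b) ∨ (b ≤ a ∧ a ≤ 0)) : softRisk a χ ≤ softRisk b χ := by
  refine integral_mono (integrable_soft_add_sub_sq hχ a) (integrable_soft_add_sub_sq hχ b)
    fun z => ?_
  simp only [soft_add_sub hχ, neg_sq]
  exact sq_clamp_le h

theorem integral_soft_scale {σ χ : ℝ} (hσ : 0 < σ) (hχ : 0 ≤ χ) (μ : Measure ℝ) :
    ∫ b, (∫ z, (soft (b + σ * z) χ - b) ^ 2 ∂stdGaussian) ∂μ =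
      σ ^ 2 * ∫ b, softRisk (b / σ) (χ / σ) ∂μ := by
  simp only [soft_scale hσ hχ, mul_pow, integral_const_mul, softRisk]

theorem riskMin_soft_nonneg (μ : Measure ℝ) (σ : ℝ) : 0 ≤ riskMin soft μ σ :=
  le_ciInf fun _ => integral_nonneg fun _ => integral_nonneg fun _ => sq_nonneg _

theorem riskMin_soft_le {σ τ : ℝ} (hσ : 0 < σ) (hτ : 0 ≤ τ) (μ : Measure ℝ) :
    riskMin soft μ σ ≤ σ ^ 2 * ∫ b, softRisk (b / σ) τ ∂μ := by
  have hbdd : BddBelow (range fun χ : NNReal =>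
      ∫ b, (∫ z, (soft (b + σ * z) (χ : ℝ) - b) ^ 2 ∂stdGaussian) ∂μ) :=
    ⟨0, by
      rintro _ ⟨χ, rfl⟩
      exact integral_nonneg fun _ => integral_nonneg fun _ => sq_nonneg _⟩
  have h := ciInf_le hbdd ⟨σ * τ, mul_nonneg hσ.le hτ⟩
  have h' := integral_soft_scale hσ (mul_nonneg hσ.le hτ) μ
  rw [mul_div_cancel_left₀ _ hσ.ne'] at h'
  exact h.trans_eq h'

theorem le_riskMin_soft {σ c : ℝ} (hσ : 0 < σ) (μ : Measure ℝ)
    (h : ∀ τ, 0 ≤ τ → c ≤ ∫ b, softRisk (b / σ) τ ∂μ) : σ ^ 2 * c ≤ riskMin soft μ σ := by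
  refine le_ciInf fun χ => ?_
  rw [integral_soft_scale hσ χ.coe_nonneg]
  gcongr
  exact h _ (div_nonneg χ.coe_nonneg hσ.le)

/-- The normalized minimal risk `riskMin soft μ σ / σ ^ 2` is nonincreasing in `σ`. -/
theorem riskMin_soft_div_sq_antitone (μ : Measure ℝ) [IsFiniteMeasure μ] {σ₁ σ₂ : ℝ}
    (h₁ : 0 < σ₁) (h : σ₁ ≤ σ₂) :
    riskMin soft μ σ₂ / σ₂ ^ 2 ≤ riskMin soft μ σ₁ / σ₁ ^ 2 := by
  have h₂ := h₁.trans_le h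
  rw [le_div_iff₀ (by positivity), mul_comm]
  refine le_riskMin_soft h₁ μ fun τ hτ => ?_
  rw [div_le_iff₀ (by positivity), mul_comm]
  refine (riskMin_soft_le h₂ hτ μ).trans ?_
  refine mul_le_mul_of_nonneg_left ?_ (sq_nonneg _)
  refine integral_mono (integrable_softRisk hτ μ _) (integrable_softRisk hτ μ _)
    fun b => softRisk_mono hτ ?_
  rcases le_total 0 b with hb | hb
  · exact Or.inl ⟨by positivity, div_le_div_of_nonneg_left hb h₁ h⟩
  · refine Or.inr ⟨?_, div_nonpos_of_nonpos_of_nonneg hb h₂.le⟩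
    rw [div_le_div_iff₀ h₁ h₂]
    exact mul_le_mul_of_nonpos_left h hb

theorem one_add_sq_le_softRisk {K τ e : ℝ} (hτ : 0 ≤ τ) (hτK : τ ≤ K / 2)
    (he : ∫ z in {z : ℝ | |z| ≤ K / 4}ᶜ, (1 + z ^ 2) ∂stdGaussian ≤ e) {b : ℝ} (hb : K ≤ |b|) :
    (1 - e) * (1 + τ ^ 2) ≤ softRisk b τ := by
  have hA : MeasurableSet {z : ℝ | |z| ≤ K / 4} := measurableSet_le (by fun_prop) (by fun_prop)
  obtain ⟨t, ht, hbt⟩ : ∃ t : ℝ, t ^ 2 = τ ^ 2 ∧ ∀ z ∈ {z : ℝ | |z| ≤ K / 4},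
      (z - t) ^ 2 = (soft (b + z) τ - b) ^ 2 := by
    rcases le_total 0 b with h0 | h0
    · refine ⟨τ, rfl, fun z hz => ?_⟩
      rw [abs_of_nonneg h0] at hb
      have hz := abs_le.1 (mem_ofPred_eq ▸ hz)
      rw [soft_add_sub hτ, min_eq_right (by linarith), max_eq_right (by linarith)]; ring
    · refine ⟨-τ, by ring, fun z hz => ?_⟩
      rw [abs_of_nonpos h0] at hb
      have hz := abs_le.1 (mem_ofPred_eq ▸ hz)
      rw [soft_add_sub hτ, min_eq_left (by linarith), max_eq_left (by linarith)]; ring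
  have hi1 : Integrable (fun z : ℝ => 1 + z ^ 2) stdGaussian :=
    (integrable_const _).add integrable_sq_stdGaussian
  have hc : ∫ z in {z : ℝ | |z| ≤ K / 4}ᶜ, (z - t) ^ 2 ∂stdGaussian ≤ (1 + τ ^ 2) * e := by
    calc _ ≤ ∫ z in {z : ℝ | |z| ≤ K / 4}ᶜ, (1 + τ ^ 2) * (1 + z ^ 2) ∂stdGaussian := by
          refine integral_mono (integrable_sub_sq_stdGaussian t).integrableOn
            (hi1.const_mul _).integrableOn fun z => ?_
          simp only [← ht]
          nlinarith [sq_nonneg (1 + z * t)]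
      _ ≤ _ := by
          rw [integral_const_mul]
          gcongr
  have hs := integral_add_compl hA (integrable_sub_sq_stdGaussian t)
  rw [integral_sub_sq_stdGaussian, ht, setIntegral_congr_fun hA hbt] at hs
  have hle : ∫ z in {z : ℝ | |z| ≤ K / 4}, (soft (b + z) τ - b) ^ 2 ∂stdGaussian ≤ softRisk b τ :=
    setIntegral_le_integral (integrable_soft_add_sub_sq hτ b) (ae_of_all _ fun _ => sq_nonneg _)
  linarith

theorem sq_le_softRisk {K τ e : ℝ} (hK : 0 ≤ K) (hτK : K / 2 ≤ τ)
    (he : ∫ z in {z : ℝ | |z| ≤ K / 4}ᶜ, (1 + z ^ 2) ∂stdGaussian ≤ e) {b : ℝ} (hb : K ≤ |b|) :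
    (1 - e) * (K / 4) ^ 2 ≤ softRisk b τ := by
  have hA : MeasurableSet {z : ℝ | |z| ≤ K / 4} := measurableSet_le (by fun_prop) (by fun_prop)
  have hτ : 0 ≤ τ := by linarith
  have hi1 : Integrable (fun z : ℝ => 1 + z ^ 2) stdGaussian :=
    (integrable_const _).add integrable_sq_stdGaussian
  have hc : ∫ z in {z : ℝ | |z| ≤ K / 4}ᶜ, (1 : ℝ) ∂stdGaussian ≤ e := by
    refine (integral_mono (integrable_const _) hi1.integrableOn fun z => ?_).trans he
    simp only
    nlinarith [sq_nonneg z]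
  have hs := integral_add_compl hA (integrable_const (μ := stdGaussian) (1 : ℝ))
  have h1 : ∫ _, (1 : ℝ) ∂stdGaussian = 1 := by simp
  have hle : ∫ z in {z : ℝ | |z| ≤ K / 4}, (soft (b + z) τ - b) ^ 2 ∂stdGaussian ≤ softRisk b τ :=
    setIntegral_le_integral (integrable_soft_add_sub_sq hτ b) (ae_of_all _ fun _ => sq_nonneg _)
  refine le_trans ?_ hle
  have hlow : ∫ z in {z : ℝ | |z| ≤ K / 4}, 1 * (K / 4) ^ 2 ∂stdGaussian ≤
      ∫ z in {z : ℝ | |z| ≤ K / 4}, (soft (b + z) τ - b) ^ 2 ∂stdGaussian := by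
    refine setIntegral_mono_on (integrable_const _)
      (integrable_soft_add_sub_sq hτ b).integrableOn hA fun z hz => ?_
    have hz := abs_le.1 (mem_ofPred_eq ▸ hz)
    rw [soft_add_sub hτ, neg_sq, one_mul]
    rcases le_total 0 b with h0 | h0
    · rw [abs_of_nonneg h0] at hb
      have : K / 4 ≤ max (-τ - z) (min b (τ - z)) :=
        le_max_of_le_right (le_min (by linarith) (by linarith))
      gcongr
    · rw [abs_of_nonpos h0] at hb
      have : max (-τ - z) (min b (τ - z)) ≤ -(K / 4) :=
        max_le (by linarith) (min_le_of_left_le (by linarith))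
      nlinarith
  refine le_trans ?_ hlow
  rw [integral_mul_const]
  gcongr
  linarith

theorem tendsto_tail_stdGaussian :
    Tendsto (fun K : ℝ => ∫ z in {z : ℝ | |z| ≤ K / 4}ᶜ, (1 + z ^ 2) ∂stdGaussian) atTop
      (nhds 0) := by
  have hi1 : Integrable (fun z : ℝ => 1 + z ^ 2) stdGaussian :=
    (integrable_const _).add integrable_sq_stdGaussian
  have h := tendsto_setIntegral_of_antitone (μ := stdGaussian) (f := fun z : ℝ => 1 + z ^ 2)
    (s := fun K : ℝ => {z : ℝ | |z| ≤ K / 4}ᶜ)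
    (fun K => (measurableSet_le (by fun_prop) (by fun_prop)).compl)
    (fun K L hKL z hz hz' => hz (show |z| ≤ L / 4 by have : |z| ≤ K / 4 := hz'; linarith))
    ⟨0, hi1.integrableOn⟩
  have he : ⋂ K : ℝ, {z : ℝ | |z| ≤ K / 4}ᶜ = ∅ := by
    refine eq_empty_of_forall_notMem fun z hz => mem_iInter.1 hz (4 * |z|) ?_
    simp only [mem_ofPred_eq]
    linarith
  simpa [he] using h

/-- A probability measure without an atom at `0` puts almost all its mass far out when rescaled. -/
theorem exists_scale_mass (g : Measure ℝ) [IsProbabilityMeasure g] (hg0 : g {0} = 0) (K : ℝ)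
    {ρ : ℝ} (hρ : ρ < 1) : ∃ σ : ℝ, 0 < σ ∧ ρ < g.real {b | K ≤ |b / σ|} := by
  have h := tendsto_measure_iUnion_atTop (μ := g)
    (s := fun n : ℕ => {b : ℝ | K ≤ (n + 1) * |b|}) fun m n hmn b (hb : K ≤ _) =>
      show K ≤ _ from hb.trans (by gcongr)
  have hsub : ({0} : Set ℝ)ᶜ ⊆ ⋃ n : ℕ, {b : ℝ | K ≤ (n + 1) * |b|} := by
    intro b hb
    obtain ⟨n, hn⟩ := exists_nat_ge (K / |b|)
    have hb' : 0 < |b| := abs_pos.2 hb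
    rw [div_le_iff₀ hb'] at hn
    exact mem_iUnion.2 ⟨n, show K ≤ _ by nlinarith⟩
  have h1 : g (⋃ n : ℕ, {b : ℝ | K ≤ (n + 1) * |b|}) = 1 := by
    refine le_antisymm prob_le_one ?_
    rw [← (prob_compl_eq_one_iff (measurableSet_singleton (0 : ℝ))).2 hg0]
    exact measure_mono hsub
  rw [h1] at h
  have h' := (ENNReal.tendsto_toReal ENNReal.one_ne_top).comp h
  obtain ⟨n, hn⟩ := (h'.eventually_const_lt (u := ρ) (by simpa using hρ)).exists
  refine ⟨1 / ((n : ℝ) + 1), by positivity, ?_⟩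
  have hset : {b : ℝ | K ≤ |b / (1 / ((n : ℝ) + 1))|} = {b : ℝ | K ≤ (n + 1) * |b|} := by
    ext b
    rw [mem_ofPred_eq, mem_ofPred_eq, div_div_eq_mul_div, div_one, abs_mul,
      abs_of_pos (by positivity : (0 : ℝ) < n + 1), mul_comm]
  rw [hset]
  exact hn

theorem isProbabilityMeasure_mix {ε : ℝ} (hε : ε ∈ Ioo (0 : ℝ) 1) (g : Measure ℝ)
    [IsProbabilityMeasure g] : IsProbabilityMeasure (mix ε g) := by
  constructor
  simp only [mix, Measure.add_apply, Measure.smul_apply, measure_univ, smul_eq_mul, mul_one]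
  rw [← ENNReal.ofReal_add (by linarith [hε.2]) hε.1.le]
  simp

theorem integral_mix {ε : ℝ} (hε : ε ∈ Ioo (0 : ℝ) 1) (g : Measure ℝ) [IsProbabilityMeasure g]
    {f : ℝ → ℝ} (hf : Integrable f g) :
    ∫ b, f b ∂(mix ε g) = (1 - ε) * f 0 + ε * ∫ b, f b ∂g := by
  have hd : Integrable f (Measure.dirac (0 : ℝ)) := integrable_dirac (by simp)
  rw [mix, integral_add_measure (hd.smul_measure ENNReal.ofReal_ne_top)
    (hf.smul_measure ENNReal.ofReal_ne_top), integral_smul_measure, integral_smul_measure,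
    integral_dirac, ENNReal.toReal_ofReal (by linarith [hε.2]), ENNReal.toReal_ofReal hε.1.le]
  simp

theorem M1_le {ε χ : ℝ} (hε : ε ∈ Ioo (0 : ℝ) 1) (hχ : 0 ≤ χ) :
    M1 ε ≤ (1 - ε) * softRisk 0 χ + ε * (1 + χ ^ 2) := by
  have hbdd : BddBelow (range fun χ : NNReal =>
      (1 - ε) * ∫ z, (soft z (χ : ℝ)) ^ 2 ∂stdGaussian + ε * (1 + (χ : ℝ) ^ 2)) :=
    ⟨0, by
      rintro _ ⟨χ, rfl⟩
      have h1 : 0 ≤ 1 - ε := by linarith [hε.2]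
      have h2 := hε.1
      have h3 : 0 ≤ ∫ z, (soft z (χ : ℝ)) ^ 2 ∂stdGaussian := integral_nonneg fun _ => sq_nonneg _
      positivity⟩
  have h := ciInf_le hbdd ⟨χ, hχ⟩
  simp only [softRisk, zero_add, sub_zero]
  exact h

/-- For small noise levels the minimal risk exceeds `δ σ ^ 2` as soon as `δ < M1 ε`. -/
theorem exists_le_riskMin_soft {δ ε : ℝ} (hδ0 : 0 < δ) (hδ : δ < M1 ε) (hε : ε ∈ Ioo (0 : ℝ) 1)
    (g : Measure ℝ) [IsProbabilityMeasure g] (hg0 : g {0} = 0) :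
    ∃ σ : ℝ, 0 < σ ∧ σ ^ 2 * δ ≤ riskMin soft (mix ε g) σ := by
  have hM : 0 < M1 ε := hδ0.trans hδ
  have hε0 := hε.1
  have hε1 : 0 < 1 - ε := by linarith [hε.2]
  obtain ⟨ρ, hρ0, hρ1, hρ⟩ : ∃ ρ : ℝ, 0 < ρ ∧ ρ < 1 ∧ δ ≤ ρ * ρ * M1 ε := by
    refine ⟨√(δ / M1 ε), by positivity, ?_, ?_⟩
    · rw [Real.sqrt_lt' one_pos, one_pow, div_lt_one hM]
      exact hδ
    · rw [Real.mul_self_sqrt (by positivity), div_mul_cancel₀ _ hM.ne']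
  have hlarge : ∀ᶠ K : ℝ in atTop, δ / (ε * ρ * ρ) ≤ (K / 4) ^ 2 :=
    ((tendsto_pow_atTop two_ne_zero).comp
      (tendsto_id.atTop_div_const (by norm_num : (0 : ℝ) < 4))).eventually_ge_atTop _
  obtain ⟨K, hKe, hK4, hK0⟩ := ((tendsto_tail_stdGaussian.eventually_le_const
    (by linarith : 0 < 1 - ρ)).and (hlarge.and (eventually_ge_atTop 0))).exists
  rw [div_le_iff₀ (by positivity)] at hK4
  obtain ⟨σ, hσ, hmass⟩ := exists_scale_mass g hg0 K hρ1
  refine ⟨σ, hσ, le_riskMin_soft hσ _ fun τ hτ => ?_⟩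
  rw [integral_mix hε g (integrable_softRisk hτ g σ), zero_div]
  have hmeas : MeasurableSet {b : ℝ | K ≤ |b / σ|} := measurableSet_le (by fun_prop) (by fun_prop)
  have key : ∀ c : ℝ, 0 ≤ c → (∀ b, K ≤ |b| → c ≤ softRisk b τ) →
      ρ * c ≤ ∫ b, softRisk (b / σ) τ ∂g := by
    intro c hc h
    calc ρ * c ≤ g.real {b : ℝ | K ≤ |b / σ|} * c := by gcongr
      _ = ∫ b in {b : ℝ | K ≤ |b / σ|}, c ∂g := by simp
      _ ≤ ∫ b in {b : ℝ | K ≤ |b / σ|}, softRisk (b / σ) τ ∂g :=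
          setIntegral_mono_on (integrable_const _) (integrable_softRisk hτ g σ).integrableOn hmeas
            fun b hb => h _ hb
      _ ≤ _ := setIntegral_le_integral (integrable_softRisk hτ g σ)
          (ae_of_all _ fun _ => softRisk_nonneg _ _)
  have hr0 := softRisk_nonneg 0 τ
  rcases le_total τ (K / 2) with hτK | hτK
  · have hk := key ((1 - (1 - ρ)) * (1 + τ ^ 2)) (by rw [sub_sub_cancel]; positivity)
      fun b hb => one_add_sq_le_softRisk hτ hτK hKe hb
    rw [sub_sub_cancel] at hk
    have hρρ : ρ * ρ ≤ 1 := by nlinarith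
    calc δ ≤ ρ * ρ * M1 ε := hρ
      _ ≤ ρ * ρ * ((1 - ε) * softRisk 0 τ + ε * (1 + τ ^ 2)) := by gcongr; exact M1_le hε hτ
      _ = ρ * ρ * ((1 - ε) * softRisk 0 τ) + ε * (ρ * (ρ * (1 + τ ^ 2))) := by ring
      _ ≤ 1 * ((1 - ε) * softRisk 0 τ) + ε * ∫ b, softRisk (b / σ) τ ∂g := by gcongr
      _ = _ := by ring
  · have hk := key ((1 - (1 - ρ)) * (K / 4) ^ 2) (by rw [sub_sub_cancel]; positivity)
      fun b hb => sq_le_softRisk hK0 hτK hKe hb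
    rw [sub_sub_cancel] at hk
    calc δ ≤ ε * (ρ * (ρ * (K / 4) ^ 2)) := by linarith
      _ ≤ ε * ∫ b, softRisk (b / σ) τ ∂g := by gcongr
      _ ≤ _ := by linarith [mul_nonneg hε1.le hr0]

/-- For `q = 1` (LASSO) with `E[G²] < ∞` and `0 < δ < M₁(ε)`, the optimally-tuned AMSE has a
strictly positive limit as `σ_w → 0⁺`. Here `σb σ_w` is the unique positive solution `σ̄` of
`σ̄² = σ_w² + (1/δ)·min_{χ≥0}E[(η₁(B+σ̄Z;χ)−B)²]` and `AMSE(σ_w) = riskMin soft (mix ε g) (σb σ_w)`. -/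
theorem lasso_amse_limit_positive
    (δ ε : ℝ) (hδ0 : 0 < δ) (hδ : δ < M1 ε) (hε : ε ∈ Ioo (0:ℝ) 1)
    (g : Measure ℝ) [IsProbabilityMeasure g] (hg0 : g {0} = 0)
    (hG2 : Integrable (fun x => x^2) g)
    (σb : ℝ → ℝ)
    (hσb : ∀ s, 0 < s → 0 < σb s ∧
      (σb s) ^ 2 = s ^ 2 + (1/δ) * riskMin soft (mix ε g) (σb s)) :
    ∃ L : ℝ, 0 < L ∧
      Tendsto (fun s => riskMin soft (mix ε g) (σb s)) (nhdsWithin (0:ℝ) (Ioi 0)) (nhds L) := by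
  have := isProbabilityMeasure_mix hε g
  obtain ⟨σ₀, hσ₀, hle⟩ := exists_le_riskMin_soft hδ0 hδ hε g hg0
  set R := riskMin soft (mix ε g) with hR
  have hfix : ∀ s, 0 < s → R (σb s) = δ * ((σb s) ^ 2 - s ^ 2) := by
    intro s hs
    rw [(hσb s hs).2]
    field_simp
    ring
  have hratio : ∀ s, 0 < s → s ^ 2 = (σb s) ^ 2 * (1 - R (σb s) / (σb s) ^ 2 / δ) := by
    intro s hs
    have hpos := (hσb s hs).1
    have h := hfix s hs
    field_simp
    linarith
  have hanti : ∀ {a b : ℝ}, 0 < a → a ≤ b → R b / b ^ 2 ≤ R a / a ^ 2 := fun ha hab =>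
    riskMin_soft_div_sq_antitone _ ha hab
  have hlow : ∀ s, 0 < s → σ₀ ≤ σb s := by
    intro s hs
    by_contra! hlt
    have hpos := (hσb s hs).1
    have h1 : δ ≤ R (σb s) / (σb s) ^ 2 := by
      refine le_trans ?_ (hanti hpos hlt.le)
      rw [le_div_iff₀ (by positivity), mul_comm]
      exact hle
    have h2 : 1 ≤ R (σb s) / (σb s) ^ 2 / δ := by rwa [le_div_iff₀ hδ0, one_mul]
    have h3 := hratio s hs
    have h4 : (σb s) ^ 2 * (1 - R (σb s) / (σb s) ^ 2 / δ) ≤ 0 :=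
      mul_nonpos_of_nonneg_of_nonpos (by positivity) (by linarith)
    have : 0 < s ^ 2 := by positivity
    linarith
  have hmono : MonotoneOn σb (Ioi 0) := by
    intro s hs t ht hst
    by_contra! hlt
    rw [mem_Ioi] at hs ht
    have hpos := (hσb t ht).1
    have h1 := hanti hpos hlt.le
    have h2 := hratio t ht
    have h3 : 0 < 1 - R (σb t) / (σb t) ^ 2 / δ := by
      have : 0 < (σb t) ^ 2 * (1 - R (σb t) / (σb t) ^ 2 / δ) := h2 ▸ by positivity
      exact pos_of_mul_pos_right this (by positivity)
    have h4 : t ^ 2 < s ^ 2 := by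
      calc t ^ 2 = _ := h2
        _ < (σb s) ^ 2 * (1 - R (σb t) / (σb t) ^ 2 / δ) := by gcongr
        _ ≤ (σb s) ^ 2 * (1 - R (σb s) / (σb s) ^ 2 / δ) := by gcongr
        _ = s ^ 2 := (hratio s hs).symm
    exact absurd h4 (not_lt.2 (by gcongr))
  have hbdd : σ₀ ∈ lowerBounds (σb '' Ioi 0) := by
    rintro _ ⟨s, hs, rfl⟩
    exact hlow s hs
  have hlim := hmono.tendsto_nhdsGT ⟨σ₀, hbdd⟩
  have hL : σ₀ ≤ sInf (σb '' Ioi 0) := le_csInf (nonempty_Ioi.image _) hbdd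
  have hL0 := hσ₀.trans_le hL
  refine ⟨δ * ((sInf (σb '' Ioi 0)) ^ 2 - 0 ^ 2), by simp; positivity, ?_⟩
  have hs : Tendsto (fun s : ℝ => s) (nhdsWithin (0 : ℝ) (Ioi 0)) (nhds 0) :=
    tendsto_id.mono_left nhdsWithin_le_nhds
  refine (((hlim.pow 2).sub (hs.pow 2)).const_mul δ).congr' ?_
  filter_upwards [self_mem_nhdsWithin] with s hs
  exact (hfix s hs).symm
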